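/- arXiv:2503.03494 — 3 statements merged into one kernel-verified Lean document; each statement's English description precedes it below -/
import Mathlib

section
/- Let p be a prime, G a finite commutative group of order p, and let g, u ∈ G with u ≠ 1. Let s, t, w, w' be integers such that p does not divide t. Then (g^s · u^{w'})^t · u^{-(w·t)} = (g^t)^s if and only if p divides w' − w. (This is correctness of the PPET protocol: the verifier's check z = y^s, with commitment v = g^s·u^{w'}, prover response y = g^t, z = v^t·u^{-wt}, succeeds exactly when the prover's witness w and the verifier's guess w' agree modulo p.) -/
theorem ppet_correctness {G : Type*} [CommGroup G] [Fintype G] (p : ℕ) (hp : p.Prime)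
    (hcard : Fintype.card G = p) (g u : G) (hu : u ≠ 1)
    (s t w w' : ℤ) (ht : ¬ (p : ℤ) ∣ t) :
    (g ^ s * u ^ w') ^ t * u ^ (-(w * t)) = (g ^ t) ^ s ↔ (p : ℤ) ∣ (w' - w) := by
  have hord : orderOf u = p :=
    ((Nat.dvd_prime hp).mp (hcard ▸ orderOf_dvd_card)).resolve_left (mt orderOf_eq_one_iff.mp hu)
  have hfactor : (g ^ s * u ^ w') ^ t * u ^ (-(w * t)) = (g ^ t) ^ s * u ^ ((w' - w) * t) := by
    rw [mul_zpow, ← zpow_mul, ← zpow_mul, ← zpow_mul, mul_assoc, ← zpow_add, mul_comm s t]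
    ring_nf
  rw [hfactor, mul_eq_left, ← orderOf_dvd_iff_zpow_eq_one, hord,
    (Nat.prime_iff_prime_int.mp hp).dvd_mul, or_iff_left ht]
end

section
/- Let X, K, N, C, q be natural numbers with X ≥ 2^K + 2, 1 ≤ C ≤ N, 1 ≤ q, and (q : ℝ) < 2^C. Then, in the reals, 1 − (1 − ((X − 2^K : ℝ)^C − (q : ℝ)/(N.choose C))⁻¹)^q ≤ (q : ℝ)/(2^C − q). -/
theorem scenario_one_bound (X K N C q : ℕ)
    (hX : 2 ^ K + 2 ≤ X) (hC1 : 1 ≤ C) (hCN : C ≤ N) (hq : 1 ≤ q)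
    (hq2 : (q : ℝ) < 2 ^ C) :
    1 - (1 - (((X : ℝ) - 2 ^ K) ^ C - (q : ℝ) / (N.choose C))⁻¹) ^ q
      ≤ (q : ℝ) / (2 ^ C - q) := by
  have hgap : (1 : ℝ) ≤ 2 ^ C - q := by
    have h : q + 1 ≤ 2 ^ C := by exact_mod_cast hq2
    have h' : (q : ℝ) + 1 ≤ 2 ^ C := by exact_mod_cast h
    linarith
  have hbase : (2 : ℝ) ≤ (X : ℝ) - 2 ^ K := by
    have h : (2 : ℝ) ^ K + 2 ≤ X := by exact_mod_cast hX
    linarith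
  have hpow : (2 : ℝ) ^ C ≤ ((X : ℝ) - 2 ^ K) ^ C := by gcongr
  have hdiv : (q : ℝ) / (N.choose C) ≤ q :=
    div_le_self q.cast_nonneg (by exact_mod_cast Nat.choose_pos hCN)
  set D : ℝ := ((X : ℝ) - 2 ^ K) ^ C - (q : ℝ) / (N.choose C)
  have hD : (2 : ℝ) ^ C - q ≤ D := sub_le_sub hpow hdiv
  have hD1 : D⁻¹ ≤ 1 := inv_le_one_of_one_le₀ (hgap.trans hD)
  have bernoulli : 1 + (q : ℝ) * -D⁻¹ ≤ (1 + -D⁻¹) ^ q :=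
    one_add_mul_le_pow (by linarith) q
  have hinv : (q : ℝ) * D⁻¹ ≤ q / (2 ^ C - q) := by
    rw [div_eq_mul_inv]
    gcongr
  rw [← sub_eq_add_neg] at bernoulli
  linarith
end

section
/- In the real numbers, with e = (2^64 − 10^6/2^17)⁻¹ and r = 4 · 10^6 / 2^17, it holds that 1 − (1 − e) ^ r ≤ 2^(−59), where (1 − e) ^ r denotes the real power (rpow) with real exponent r. -/
/-- The Bernoulli-type upper bound `1 - (1 - e) ^ r ≤ r * e` for real exponents `r ≥ 1`. -/
theorem one_sub_rpow_one_sub_le {e r : ℝ} (he : e ≤ 1) (hr : 1 ≤ r) :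
    1 - (1 - e) ^ r ≤ r * e := by
  have h := one_add_mul_self_le_rpow_one_add (neg_le_neg he) hr
  rw [← sub_eq_add_neg] at h
  linarith

theorem scenario_two_bound :
    1 - (1 - ((2 ^ 64 - 10 ^ 6 / 2 ^ 17 : ℝ))⁻¹) ^ (4 * 10 ^ 6 / 2 ^ 17 : ℝ)
      ≤ (2 : ℝ) ^ (-59 : ℤ) := by
  refine (one_sub_rpow_one_sub_le ?_ ?_).trans ?_ <;> norm_num
end
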